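/- The assignment ([s₁:t₁],[s₂:t₂],[s₃:t₃]) ↦ [u₁:u₂:u₃:u₄], where u₁ = s₁s₂t₃ − t₁s₂s₃, u₂ = s₁t₂t₃ − t₁t₂s₃, u₃ = s₁s₂t₃ − s₁t₂s₃, u₄ = t₁s₂t₃ − t₁t₂s₃, is well defined on triples of pairwise distinct points of ℙ¹(ℂ) (i.e., (u₁,u₂,u₃,u₄) ≠ (0,0,0,0) and the projective image is independent of the choice of representatives), and it defines a bijection from the set of ordered triples of pairwise distinct points of ℙ¹(ℂ) onto the complement in ℙ³(ℂ) of the quadric surface {[u₁:u₂:u₃:u₄] : u₁u₄ = u₂u₃}. -/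

import Mathlib

noncomputable section

/-- The quadruple `(u₁,u₂,u₃,u₄)` associated with a triple of points `[sᵢ:tᵢ]` of `ℙ¹`,
defining the birational map `(ℙ¹)³ ⤏ ℙ³` of the paper. -/
def Uvec (s t : Fin 3 → ℂ) : Fin 4 → ℂ :=
  ![s 0 * s 1 * t 2 - t 0 * s 1 * s 2,
    s 0 * t 1 * t 2 - t 0 * t 1 * s 2,
    s 0 * s 1 * t 2 - s 0 * t 1 * s 2,
    t 0 * s 1 * t 2 - t 0 * t 1 * s 2]

/-- The representatives `(sᵢ,tᵢ)` define pairwise distinct points of `ℙ¹(ℂ)`. -/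
def PairwiseDistinct (s t : Fin 3 → ℂ) : Prop :=
  ∀ i j : Fin 3, i ≠ j → s i * t j - s j * t i ≠ 0

/-- The quadratic form `u₁u₄ - u₂u₃` pulls back to the product of the three minors, up to sign. -/
theorem Uvec_quadric (s t : Fin 3 → ℂ) :
    Uvec s t 0 * Uvec s t 3 - Uvec s t 1 * Uvec s t 2 =
      -((s 0 * t 1 - s 1 * t 0) * (s 0 * t 2 - s 2 * t 0) * (s 1 * t 2 - s 2 * t 1)) := by
  simp [Uvec]
  ring

/-- The assignment `([s₁:t₁],[s₂:t₂],[s₃:t₃]) ↦ [u₁:u₂:u₃:u₄]` is well defined on triples of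
pairwise distinct points of `ℙ¹(ℂ)`, and defines a bijection from the set of ordered triples
of pairwise distinct points of `ℙ¹(ℂ)` onto the complement in `ℙ³(ℂ)` of the quadric
`{u₁u₄ = u₂u₃}`: the image vector is nonzero, independent of representatives up to scalar,
lands in the quadric complement, every point of the quadric complement is hit, and triples
with projectively equivalent images are projectively equal. -/
theorem Uvec_bijection :
    -- well defined: the image is a nonzero vector of ℂ⁴
    (∀ s t : Fin 3 → ℂ, PairwiseDistinct s t → Uvec s t ≠ 0) ∧
    -- well defined: rescaling representatives rescales the image vector
    (∀ s t : Fin 3 → ℂ, ∀ α : Fin 3 → ℂ, (∀ i, α i ≠ 0) →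
      Uvec (fun i => α i * s i) (fun i => α i * t i) = (α 0 * α 1 * α 2) • Uvec s t) ∧
    -- the image avoids the quadric u₁u₄ = u₂u₃
    (∀ s t : Fin 3 → ℂ, PairwiseDistinct s t →
      Uvec s t 0 * Uvec s t 3 ≠ Uvec s t 1 * Uvec s t 2) ∧
    -- surjectivity onto the complement of the quadric
    (∀ u : Fin 4 → ℂ, u 0 * u 3 ≠ u 1 * u 2 →
      ∃ s t : Fin 3 → ℂ, PairwiseDistinct s t ∧ ∃ c : ℂ, c ≠ 0 ∧ Uvec s t = c • u) ∧
    -- injectivity: projectively equal images come from projectively equal triples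
    (∀ s t s' t' : Fin 3 → ℂ, PairwiseDistinct s t → PairwiseDistinct s' t' →
      (∃ c : ℂ, c ≠ 0 ∧ Uvec s' t' = c • Uvec s t) →
      ∀ i : Fin 3, s i * t' i - s' i * t i = 0) := by
  have quadric : ∀ s t : Fin 3 → ℂ, PairwiseDistinct s t →
      Uvec s t 0 * Uvec s t 3 ≠ Uvec s t 1 * Uvec s t 2 := by
    intro s t h heq
    rw [← sub_eq_zero, Uvec_quadric] at heq
    exact neg_ne_zero.mpr (mul_ne_zero (mul_ne_zero (h 0 1 (by decide)) (h 0 2 (by decide)))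
      (h 1 2 (by decide))) heq
  refine ⟨?_, ?_, quadric, ?_, ?_⟩
  · intro s t h h0
    exact quadric s t h (by simp [h0])
  · intro s t α _
    ext i
    fin_cases i <;> simp [Uvec] <;> ring
  · intro u hu
    have hq : u 1 * u 2 - u 0 * u 3 ≠ 0 := sub_ne_zero.mpr hu.symm
    refine ⟨![u 2, u 0, u 0 - u 2], ![u 3, u 1, u 1 - u 3], ?_, _, hq, ?_⟩
    · intro i j hij h
      apply hq
      fin_cases i <;> fin_cases j <;> simp at hij h <;>
        first
          | linear_combination h
          | linear_combination -h
    · ext i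
      fin_cases i <;> simp [Uvec] <;> ring
  · rintro s t s' t' - h' ⟨c, -, hc⟩ i
    have h0 := congrFun hc 0
    have h1 := congrFun hc 1
    have h2 := congrFun hc 2
    have h3 := congrFun hc 3
    simp [Uvec] at h0 h1 h2 h3
    fin_cases i <;> simp only [Fin.zero_eta, Fin.mk_one, Fin.reduceFinMk]
    · refine (mul_eq_zero.mp ?_).resolve_left (h' 1 2 (by decide))
      linear_combination s 0 * h3 - t 0 * h2
    · refine (mul_eq_zero.mp ?_).resolve_left (h' 0 2 (by decide))
      linear_combination s 1 * h1 - t 1 * h0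
    · refine (mul_eq_zero.mp ?_).resolve_left (h' 0 1 (by decide))
      linear_combination s 2 * (h1 - h3) - t 2 * (h0 - h2)
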